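/- arXiv:2104.14249 — 2 statements merged into one kernel-verified Lean document; each statement's English description precedes it below -/
import Mathlib

section
/- Let Φ = {φ_a}_{a∈A} be an IFS on ℝ^d with attractor X and coding map π, and let Ψ : ⋃_{n≥1}A^n → [0,∞). For any s ≥ 0, if Σ_{n=1}^∞ Σ_{a∈A^n} n·Ψ(a)^s < ∞, then the s-dimensional Hausdorff measure of W_Φ(Ψ) is zero: ℋ^s(W_Φ(Ψ)) = 0. -/
open MeasureTheory Filter Metric Set

noncomputable section

/-- The composition `φ_{a_1} ∘ ⋯ ∘ φ_{a_n}` associated to a finite word `a ∈ A^n`. -/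
def iterMap {A E : Type*} (φ : A → E → E) : {n : ℕ} → (Fin n → A) → E → E :=
  fun a => (List.ofFn (fun i => φ (a i))).foldr (· ∘ ·) id

/-- The eventually periodic sequence `a_1⋯a_l (a_{l+1}⋯a_n)^∞` with preperiod `a_1⋯a_l`
and period `a_{l+1}⋯a_n`. -/
def evp {A : Type*} {n : ℕ} (a : Fin n → A) (l : ℕ) (h : l < n) : ℕ → A := fun i =>
  if hi : i < l then a ⟨i, hi.trans h⟩
  else a ⟨l + (i - l) % (n - l), by
    have h1 : (i - l) % (n - l) < n - l := Nat.mod_lt _ (by omega)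
    omega⟩

/-- The limsup set `W_Φ(Ψ)`: points `x` such that for infinitely many `n` there are
`a ∈ A^n` and `0 ≤ l ≤ n-1` with `‖x - π(a_1⋯a_l(a_{l+1}⋯a_n)^∞)‖ < Ψ(a)`. -/
def limsupW {A : Type*} {d : ℕ} (π : (ℕ → A) → EuclideanSpace ℝ (Fin d))
    (Ψ : (n : ℕ) → (Fin n → A) → ℝ) : Set (EuclideanSpace ℝ (Fin d)) :=
  {x | ∃ᶠ n in atTop, ∃ a : Fin n → A, ∃ l : ℕ, ∃ h : l < n,
    ‖x - π (evp a l h)‖ < Ψ n a}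

/-- The cylinder set `[a]` of sequences starting with the word `a`. -/
def cyl {A : Type*} {n : ℕ} (a : Fin n → A) : Set (ℕ → A) := {σ | ∀ i : Fin n, σ i = a i}

/-- Borel–Cantelli lemma for Hausdorff measures: a limsup set of balls whose radii `ρ` satisfy
`∑ ρ ^ s < ∞` has zero `s`-dimensional Hausdorff measure, for `0 < s`. -/
theorem hausdorffMeasure_limsup_ball_eq_zero {E : Type*} [MetricSpace E] [MeasurableSpace E]
    [BorelSpace E] {ι : ℕ → Type*} [∀ n, Fintype (ι n)] (c : (n : ℕ) → ι n → E)
    (ρ : (n : ℕ) → ι n → ℝ) (hρ : ∀ n i, 0 ≤ ρ n i) {s : ℝ} (hs : 0 < s)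
    (hsum : Summable fun n => ∑ i, ρ n i ^ s) :
    μH[s] {x | ∃ᶠ n in atTop, ∃ i, dist x (c n i) < ρ n i} = 0 := by
  set F : ℕ → ENNReal := fun n => ∑ i, ENNReal.ofReal (ρ n i) ^ s with hF
  have hFsum : ∑' n, F n ≠ ⊤ := by
    convert hsum.tsum_ofReal_ne_top using 4 with n
    rw [hF, ENNReal.ofReal_sum_of_nonneg fun i _ => Real.rpow_nonneg (hρ n i) s]
    exact Finset.sum_congr rfl fun i _ => ENNReal.ofReal_rpow_of_nonneg (hρ n i) hs.le
  have htail : Tendsto (fun N => ∑' k, F (k + N)) atTop (nhds 0) :=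
    ENNReal.tendsto_sum_nat_add F hFsum
  have hdiam : ∀ n i, ediam (ball (c n i) (ρ n i)) ≤ 2 * ENNReal.ofReal (ρ n i) := fun n i => by
    rw [← eball_ofReal]
    exact ediam_eball_le
  have hrad : Tendsto (fun N => 2 * (∑' k, F (k + N)) ^ s⁻¹) atTop (nhds 0) := by
    have h := ENNReal.Tendsto.const_mul (a := 2) (htail.ennrpow_const s⁻¹)
      (Or.inr ENNReal.ofNat_ne_top)
    simpa [ENNReal.zero_rpow_of_pos (inv_pos.2 hs)] using h
  have hbound : Tendsto (fun N => 2 ^ s * ∑' k, F (k + N)) atTop (nhds 0) := by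
    simpa using ENNReal.Tendsto.const_mul (a := 2 ^ s) htail
      (Or.inr (ENNReal.rpow_ne_top_of_nonneg hs.le ENNReal.ofNat_ne_top))
  refine le_antisymm ?_ (zero_le)
  refine (Measure.hausdorffMeasure_le_liminf_tsum (ι := fun N : ℕ => Σ k : ℕ, ι (k + N)) s _ _
    hrad (fun N p => ball (c _ p.2) (ρ _ p.2)) ?_ ?_).trans ?_
  · refine Eventually.of_forall fun N p => (hdiam _ _).trans ?_
    gcongr
    rw [ENNReal.le_rpow_inv_iff hs]
    exact (Finset.single_le_sum (f := fun i => ENNReal.ofReal (ρ (p.1 + N) i) ^ s)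
      (fun _ _ => zero_le) (Finset.mem_univ p.2)).trans (ENNReal.le_tsum p.1)
  · refine Eventually.of_forall fun N x hx => ?_
    obtain ⟨n, hn, i, hi⟩ := frequently_atTop.1 hx N
    obtain ⟨k, rfl⟩ := Nat.exists_eq_add_of_le' hn
    exact mem_iUnion.2 ⟨⟨k, i⟩, hi⟩
  · rw [← hbound.liminf_eq]
    refine liminf_le_liminf (Eventually.of_forall fun N => ?_)
    rw [ENNReal.tsum_sigma', ← ENNReal.tsum_mul_left]
    refine ENNReal.tsum_le_tsum fun k => ?_
    rw [tsum_fintype, hF, Finset.mul_sum]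
    refine Finset.sum_le_sum fun i _ => ?_
    rw [← ENNReal.mul_rpow_of_nonneg _ _ hs.le]
    exact ENNReal.rpow_le_rpow (hdiam _ _) hs.le

/-- Theorem 1.1(1) of the paper: if `Σ_n Σ_{a ∈ A^n} n·Ψ(a)^s < ∞`
then `ℋ^s(W_Φ(Ψ)) = 0`. -/
theorem statement0 {d : ℕ} {A : Type*} [Fintype A]
    (hA : 2 ≤ Fintype.card A)
    (φ : A → EuclideanSpace ℝ (Fin d) → EuclideanSpace ℝ (Fin d))
    (r : A → ℝ) (hr : ∀ a, r a ∈ Set.Ioo (0 : ℝ) 1)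
    (hsim : ∀ a x y, ‖φ a x - φ a y‖ = r a * ‖x - y‖)
    (X : Set (EuclideanSpace ℝ (Fin d)))
    (hXne : X.Nonempty) (hXcomp : IsCompact X)
    (hXinv : X = ⋃ a, φ a '' X)
    (π : (ℕ → A) → EuclideanSpace ℝ (Fin d))
    (hπ : ∀ (σ : ℕ → A) (n : ℕ), π σ ∈ iterMap φ (fun i : Fin n => σ i) '' X)
    (Ψ : (n : ℕ) → (Fin n → A) → ℝ) (hΨ : ∀ n a, 0 ≤ Ψ n a)
    (s : ℝ) (hs : 0 ≤ s)
    (hconv : Summable fun n : ℕ => ∑ a : Fin n → A, (n : ℝ) * Ψ n a ^ s) :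
    μH[s] (limsupW π Ψ) = 0 := by
  have hs' : 0 < s := by
    refine hs.lt_of_ne' fun h => ?_
    subst h
    have : Nonempty A := Fintype.card_pos_iff.1 (by omega)
    refine not_tendsto_nhds_of_tendsto_atTop ?_ 0 hconv.tendsto_atTop_zero
    refine tendsto_atTop_mono (fun n => ?_) tendsto_natCast_atTop_atTop
    simp only [Real.rpow_zero, mul_one, Finset.sum_const, nsmul_eq_mul, Finset.card_univ]
    exact le_mul_of_one_le_left (Nat.cast_nonneg n) (by exact_mod_cast Fintype.card_pos)
  have key := hausdorffMeasure_limsup_ball_eq_zero (ι := fun n => (Fin n → A) × Fin n)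
    (fun n p => π (evp p.1 p.2 p.2.isLt)) (fun n p => Ψ n p.1) (fun n p => hΨ n p.1) hs' (by
      simpa [Fintype.sum_prod_type] using hconv)
  refine measure_mono_null (fun x hx => ?_) key
  refine Frequently.mono hx ?_
  rintro n ⟨a, l, h, hlt⟩
  exact ⟨(a, ⟨l, h⟩), by simpa [dist_eq_norm] using hlt⟩
end
end

section
/- Let Φ = {φ_a}_{a∈A} be an IFS on ℝ^d with attractor X, coding map π, similarity dimension dim_S(Φ), probability vector p_a = r_a^{dim_S(Φ)}, entropy h_p, and self-similar measure μ. Assume h_p < −2·log(Σ_{a∈A} p_a²). Let g : ℕ → [0,∞) be non-increasing and set Ψ(a) := diam(X_a)·g(|a|). If Σ_{n=1}^∞ Σ_{a∈A^n} n·(diam(X_a)·g(n))^{dim_S(Φ)} = ∞, then μ(W_Φ(Ψ)) = 1. -/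
open MeasureTheory Filter Metric Set

noncomputable section

section Bernoulli

open ProbabilityTheory

variable {A : Type*} [Fintype A] [MeasurableSpace A] [MeasurableSingletonClass A]

/-- A measure with Bernoulli cylinder masses is the infinite product of its first marginal. -/
lemma eq_infinitePi_of_cyl {p : A → ℝ} (hp0 : ∀ a, 0 ≤ p a) (P : Measure (ℕ → A))
    [IsProbabilityMeasure P]
    (hP : ∀ (n : ℕ) (a : Fin n → A), P (cyl a) = ENNReal.ofReal (∏ i, p (a i))) :
    ∃ (P₀ : Measure A) (_ : IsProbabilityMeasure P₀),
      (∀ a, P₀ {a} = ENNReal.ofReal (p a)) ∧ P = Measure.infinitePi (fun _ => P₀) := by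
  classical
  have h0 : ∀ a, P.map (fun σ => σ 0) {a} = ENNReal.ofReal (p a) := by
    intro a
    rw [Measure.map_apply (measurable_pi_apply 0) (measurableSet_singleton a)]
    have h := hP 1 (fun _ => a)
    simp only [Finset.univ_unique, Finset.prod_singleton] at h
    rw [← h]
    congr 1
    ext σ
    simp [cyl]
  have hprob : IsProbabilityMeasure (P.map (fun σ : ℕ → A => σ 0)) :=
    Measure.isProbabilityMeasure_map (measurable_pi_apply 0).aemeasurable
  refine ⟨_, hprob, h0, Measure.eq_infinitePi _ fun s t ht => ?_⟩
  obtain ⟨n, hn⟩ : ∃ n, s ⊆ Finset.range n := ⟨s.sup id + 1, fun i hi =>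
    Finset.mem_range.2 (Nat.lt_succ_of_le (Finset.le_sup (f := id) hi))⟩
  have hres : Measurable (fun (σ : ℕ → A) (i : Fin n) => σ i) := by fun_prop
  have hpi : P.map (fun (σ : ℕ → A) (i : Fin n) => σ i) =
      Measure.pi (fun _ => P.map (fun σ => σ 0)) := by
    refine Measure.ext_of_singleton fun a => ?_
    rw [Measure.map_apply hres (measurableSet_singleton a), Measure.pi_singleton]
    simp_rw [h0]
    rw [← ENNReal.ofReal_prod_of_nonneg fun i _ => hp0 _, ← hP]
    congr 1
    ext σ
    simp [cyl, funext_iff]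
  have hset : Set.pi (s : Set ℕ) t = (fun (σ : ℕ → A) (i : Fin n) => σ i) ⁻¹'
      Set.pi Set.univ (fun i : Fin n => if (i : ℕ) ∈ s then t i else Set.univ) := by
    ext σ
    simp only [Set.mem_pi, Set.mem_preimage, Finset.mem_coe, Set.mem_univ, forall_true_left]
    constructor
    · intro h i
      split_ifs with hi
      · exact h i hi
      · trivial
    · intro h i hi
      have := h ⟨i, Finset.mem_range.1 (hn hi)⟩
      simpa [hi] using this
  rw [hset, ← Measure.map_apply hres, hpi, Measure.pi_pi,
    Fin.prod_univ_eq_prod_range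
      (fun i => (P.map (fun σ => σ 0)) (if i ∈ s then t i else Set.univ)) n]
  · rw [← Finset.prod_subset hn]
    · exact Finset.prod_congr rfl fun i hi => by rw [if_pos hi]
    · intro i _ hi
      rw [if_neg hi, measure_univ]
  · refine MeasurableSet.univ_pi fun i => ?_
    split_ifs
    · exact ht i
    · exact MeasurableSet.univ

lemma measureReal_coords_of_cyl {p : A → ℝ} (hp0 : ∀ a, 0 ≤ p a) (P : Measure (ℕ → A))
    [IsProbabilityMeasure P]
    (hP : ∀ (n : ℕ) (a : Fin n → A), P (cyl a) = ENNReal.ofReal (∏ i, p (a i)))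
    (S : Finset ℕ) (c : ℕ → A) :
    P.real {σ | ∀ i ∈ S, σ i = c i} = ∏ i ∈ S, p (c i) := by
  obtain ⟨P₀, hprob, h0, h⟩ := eq_infinitePi_of_cyl hp0 P hP
  have hs : {σ : ℕ → A | ∀ i ∈ S, σ i = c i} = Set.pi S (fun i => {c i}) := by
    ext σ
    simp [Set.mem_pi]
  have : P {σ | ∀ i ∈ S, σ i = c i} = ∏ i ∈ S, ENNReal.ofReal (p (c i)) := by
    rw [hs]
    nth_rewrite 1 [h]
    rw [Measure.infinitePi_pi _ fun i _ => measurableSet_singleton _]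
    simp_rw [h0]
  rw [measureReal_def, this, ← ENNReal.ofReal_prod_of_nonneg fun i _ => hp0 _,
    ENNReal.toReal_ofReal (Finset.prod_nonneg fun i _ => hp0 _)]

lemma iIndep_coords_of_cyl {p : A → ℝ} (hp0 : ∀ a, 0 ≤ p a) (P : Measure (ℕ → A))
    [IsProbabilityMeasure P]
    (hP : ∀ (n : ℕ) (a : Fin n → A), P (cyl a) = ENNReal.ofReal (∏ i, p (a i))) :
    iIndep (fun k : ℕ => MeasurableSpace.comap (fun σ : ℕ → A => σ k) inferInstance) P := by
  obtain ⟨P₀, hprob, -, rfl⟩ := eq_infinitePi_of_cyl hp0 P hP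
  exact (iIndepFun_infinitePi (P := fun _ : ℕ => P₀) (X := fun _ a => a)
    fun _ => measurable_id).iIndep

lemma measurableSet_iSup_of_dependsOn (S : Finset ℕ) {F : Set (ℕ → A)}
    (hF : ∀ σ τ : ℕ → A, (∀ i ∈ S, σ i = τ i) → σ ∈ F → τ ∈ F) :
    MeasurableSet[⨆ k ∈ (S : Set ℕ),
      MeasurableSpace.comap (fun σ : ℕ → A => σ k) inferInstance] F := by
  set m : MeasurableSpace (ℕ → A) := ⨆ k ∈ (S : Set ℕ),
      MeasurableSpace.comap (fun σ : ℕ → A => σ k) inferInstance with hm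
  have hF' : F = ⋃ c ∈ {c : S → A | ∃ σ ∈ F, ∀ i : S, σ i = c i},
      ⋂ i : S, (fun σ : ℕ → A => σ i) ⁻¹' {c i} := by
    ext σ
    simp only [Set.mem_ofPred_eq, Set.mem_iUnion, Set.mem_iInter, Set.mem_preimage,
      Set.mem_singleton_iff, exists_prop]
    constructor
    · intro h
      exact ⟨fun i => σ i, ⟨σ, h, fun i => rfl⟩, fun i => rfl⟩
    · rintro ⟨c, ⟨τ, hτ, hc⟩, hσ⟩
      exact hF τ σ (fun i hi => (hc ⟨i, hi⟩).trans (hσ ⟨i, hi⟩).symm) hτ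
  rw [hF']
  refine MeasurableSet.biUnion (Set.to_countable _) fun c _ => MeasurableSet.iInter fun i => ?_
  have hle : MeasurableSpace.comap (fun σ : ℕ → A => σ i) inferInstance ≤ m :=
    le_iSup₂_of_le (i : ℕ) i.2 le_rfl
  exact hle _ ⟨{c i}, measurableSet_singleton _, rfl⟩

lemma measurableSet_of_dependsOn (S : Finset ℕ) {F : Set (ℕ → A)}
    (hF : ∀ σ τ : ℕ → A, (∀ i ∈ S, σ i = τ i) → σ ∈ F → τ ∈ F) : MeasurableSet F := by
  have hle : (⨆ k ∈ (S : Set ℕ), MeasurableSpace.comap (fun σ : ℕ → A => σ k) inferInstance) ≤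
      (inferInstance : MeasurableSpace (ℕ → A)) :=
    iSup₂_le fun k _ => (measurable_pi_apply k).comap_le
  exact hle _ (measurableSet_iSup_of_dependsOn S hF)

/-- Events determined by pairwise disjoint finite sets of coordinates are independent. -/
lemma iIndepSet_of_dependsOn {P : Measure (ℕ → A)} [IsProbabilityMeasure P]
    (hind : iIndep (fun k : ℕ => MeasurableSpace.comap (fun σ : ℕ → A => σ k) inferInstance) P)
    (B : ℕ → Finset ℕ) (hB : Pairwise fun i j => Disjoint (B i) (B j)) (F : ℕ → Set (ℕ → A))
    (hF : ∀ j, ∀ σ τ : ℕ → A, (∀ i ∈ B j, σ i = τ i) → σ ∈ F j → τ ∈ F j) :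
    iIndepSet F P := by
  classical
  rw [iIndepSet_iff_meas_biInter fun j => measurableSet_of_dependsOn (B j) (hF j)]
  intro s
  induction s using Finset.induction_on with
  | empty => simp
  | insert j s hj ih =>
    rw [Finset.prod_insert hj, Finset.set_biInter_insert, ← ih]
    have hdisj : Disjoint (B j : Set ℕ) (s.biUnion B : Finset ℕ) := by
      rw [Finset.disjoint_coe, Finset.disjoint_biUnion_right]
      intro i hi
      exact hB fun h => hj (h ▸ hi)
    have h := indep_iSup_of_disjoint (fun k => (measurable_pi_apply k).comap_le) hind hdisj
    refine Indep_iff _ _ _ |>.1 h _ _ (measurableSet_iSup_of_dependsOn (B j) (hF j))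
      (measurableSet_iSup_of_dependsOn (s.biUnion B) ?_)
    intro σ τ hστ hσ
    simp only [Set.mem_iInter] at hσ ⊢
    exact fun i hi => hF i σ τ (fun k hk => hστ k (Finset.mem_biUnion.2 ⟨i, hi, hk⟩)) (hσ i hi)

lemma measureReal_eq_sum_coords (P : Measure (ℕ → A)) [IsProbabilityMeasure P] (a₀ : A)
    (S : Finset ℕ) {E : Set (ℕ → A)} :
    P.real E = ∑ c : S → A,
      P.real (E ∩ {σ | ∀ i ∈ S, σ i = if h : i ∈ S then c ⟨i, h⟩ else a₀}) := by
  classical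
  have hm : Measurable (fun (σ : ℕ → A) (i : S) => σ i) := by fun_prop
  have h := sum_measureReal_preimage_singleton (μ := P.restrict E) (Finset.univ : Finset (S → A))
    (f := fun (σ : ℕ → A) (i : S) => σ i) (fun y _ => hm (measurableSet_singleton y))
  simp only [Finset.coe_univ, Set.preimage_univ] at h
  rw [measureReal_restrict_apply MeasurableSet.univ, Set.univ_inter] at h
  rw [← h]
  refine Finset.sum_congr rfl fun c _ => ?_
  rw [measureReal_restrict_apply (hm (measurableSet_singleton c)), Set.inter_comm]
  congr 2
  ext σ
  simp only [Set.mem_preimage, Set.mem_singleton_iff, Set.mem_ofPred_eq, funext_iff, Subtype.forall]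
  exact forall₂_congr fun i hi => by rw [dif_pos hi]

lemma measureReal_le_of_forall_coords (P : Measure (ℕ → A)) [IsProbabilityMeasure P]
    (S : Finset ℕ) {E : Set (ℕ → A)} {b : ℝ} [Nonempty A]
    (h : ∀ c : ℕ → A, P.real (E ∩ {σ | ∀ i ∈ S, σ i = c i}) ≤
      b * P.real {σ | ∀ i ∈ S, σ i = c i}) : P.real E ≤ b := by
  obtain ⟨a₀⟩ := ‹Nonempty A›
  have h1 := measureReal_eq_sum_coords P a₀ S (E := Set.univ)
  simp only [Set.univ_inter, probReal_univ] at h1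
  rw [measureReal_eq_sum_coords P a₀ S]
  calc _ ≤ _ := Finset.sum_le_sum fun c _ => h _
    _ = b := by rw [← Finset.mul_sum, ← h1, mul_one]

lemma le_measureReal_of_forall_coords (P : Measure (ℕ → A)) [IsProbabilityMeasure P]
    (S : Finset ℕ) {E : Set (ℕ → A)} {b : ℝ} [Nonempty A]
    (h : ∀ c : ℕ → A, b * P.real {σ | ∀ i ∈ S, σ i = c i} ≤
      P.real (E ∩ {σ | ∀ i ∈ S, σ i = c i})) : b ≤ P.real E := by
  obtain ⟨a₀⟩ := ‹Nonempty A›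
  have h1 := measureReal_eq_sum_coords P a₀ S (E := Set.univ)
  simp only [Set.univ_inter, probReal_univ] at h1
  rw [measureReal_eq_sum_coords P a₀ S]
  calc b = _ := by rw [← Finset.mul_sum, ← h1, mul_one]
    _ ≤ _ := Finset.sum_le_sum fun c _ => h _

end Bernoulli

section SecondMoment

/-- The Chung–Erdős inequality. -/
lemma sq_sum_measureReal_le {Ω ι : Type*} [MeasurableSpace Ω] (P : Measure Ω)
    [IsProbabilityMeasure P] (Q : Finset ι) (E : ι → Set Ω) (hE : ∀ q, MeasurableSet (E q)) :
    (∑ q ∈ Q, P.real (E q)) ^ 2 ≤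
      P.real (⋃ q ∈ Q, E q) * ∑ q ∈ Q, ∑ q' ∈ Q, P.real (E q ∩ E q') := by
  set U : Set Ω := ⋃ q ∈ Q, E q with hU
  have hUm : MeasurableSet U := Finset.measurableSet_biUnion Q fun q _ => hE q
  have hint : ∀ s : Set Ω, MeasurableSet s → Integrable (s.indicator (1 : Ω → ℝ)) P :=
    fun s hs => (integrable_const (1 : ℝ)).indicator hs
  have key : ∀ t : ℝ, 0 ≤ P.real U * (t * t) + (-2 * ∑ q ∈ Q, P.real (E q)) * t +
      ∑ q ∈ Q, ∑ q' ∈ Q, P.real (E q ∩ E q') := by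
    intro t
    have hexp : ∀ ω, (∑ q ∈ Q, (E q).indicator (1 : Ω → ℝ) ω - t * U.indicator 1 ω) ^ 2 =
        (t * t) * U.indicator 1 ω + (-2 * t) * ∑ q ∈ Q, (E q).indicator 1 ω +
          ∑ q ∈ Q, ∑ q' ∈ Q, (E q ∩ E q').indicator 1 ω := by
      intro ω
      have h1 : U.indicator (1 : Ω → ℝ) ω * U.indicator 1 ω = U.indicator 1 ω := by
        by_cases h : ω ∈ U <;> simp [h]
      have h2 : (∑ q ∈ Q, (E q).indicator (1 : Ω → ℝ) ω) * U.indicator 1 ω =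
          ∑ q ∈ Q, (E q).indicator 1 ω := by
        rw [Finset.sum_mul]
        refine Finset.sum_congr rfl fun q hq => ?_
        by_cases h : ω ∈ E q
        · have : ω ∈ U := Set.mem_biUnion hq h
          simp [h, this]
        · simp [h]
      have h3 : (∑ q ∈ Q, (E q).indicator (1 : Ω → ℝ) ω) * (∑ q ∈ Q, (E q).indicator 1 ω) =
          ∑ q ∈ Q, ∑ q' ∈ Q, (E q ∩ E q').indicator 1 ω := by
        rw [Finset.sum_mul_sum]
        refine Finset.sum_congr rfl fun q _ => Finset.sum_congr rfl fun q' _ => ?_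
        rw [Set.inter_indicator_one]
        rfl
      linear_combination h3 - 2 * t * h2 + t ^ 2 * h1
    have h0 : 0 ≤ ∫ ω, (∑ q ∈ Q, (E q).indicator (1 : Ω → ℝ) ω - t * U.indicator 1 ω) ^ 2 ∂P :=
      integral_nonneg fun ω => sq_nonneg _
    have hi1 : Integrable (fun ω => (t * t) * U.indicator (1 : Ω → ℝ) ω) P :=
      (hint U hUm).const_mul _
    have hi2 : Integrable (fun ω => (-2 * t) * ∑ q ∈ Q, (E q).indicator (1 : Ω → ℝ) ω) P :=
      (integrable_finsetSum _ fun q _ => hint _ (hE q)).const_mul _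
    have hi4 : ∀ q, Integrable (fun ω => ∑ q' ∈ Q, (E q ∩ E q').indicator (1 : Ω → ℝ) ω) P :=
      fun q => integrable_finsetSum _ fun q' _ => hint _ ((hE q).inter (hE q'))
    have hi3 : Integrable
        (fun ω => ∑ q ∈ Q, ∑ q' ∈ Q, (E q ∩ E q').indicator (1 : Ω → ℝ) ω) P :=
      integrable_finsetSum _ fun q _ => hi4 q
    have hi12 : Integrable (fun ω => (t * t) * U.indicator (1 : Ω → ℝ) ω +
        (-2 * t) * ∑ q ∈ Q, (E q).indicator (1 : Ω → ℝ) ω) P := hi1.add hi2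
    simp_rw [hexp] at h0
    rw [integral_add hi12 hi3, integral_add hi1 hi2, integral_const_mul,
      integral_const_mul, integral_finsetSum _ fun q _ => hint _ (hE q),
      integral_finsetSum _ fun q _ => hi4 q] at h0
    have h4 : ∀ q, ∫ ω, ∑ q' ∈ Q, (E q ∩ E q').indicator (1 : Ω → ℝ) ω ∂P =
        ∑ q' ∈ Q, P.real (E q ∩ E q') := by
      intro q
      rw [integral_finsetSum _ fun q' _ => hint _ ((hE q).inter (hE q'))]
      exact Finset.sum_congr rfl fun q' _ => integral_indicator_one ((hE q).inter (hE q'))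
    simp_rw [h4, integral_indicator_one hUm, fun q => integral_indicator_one (μ := P) (hE q)] at h0
    linarith
  have := discrim_le_zero key
  rw [discrim] at this
  linarith

lemma sum_pow_sub_add_sub_le {κ : ℝ} (h0 : 0 ≤ κ) (h1 : κ < 1) (F : Finset ℕ) (n : ℕ) :
    ∑ m ∈ F, κ ^ ((m - n) + (n - m)) ≤ 2 * (1 - κ)⁻¹ := by
  classical
  have hs := summable_geometric_of_lt_one h0 h1
  have key : ∀ (f : ℕ → ℕ) (G : Finset ℕ), Set.InjOn f G →
      ∑ m ∈ G, κ ^ f m ≤ (1 - κ)⁻¹ := by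
    intro f G hf
    rw [← Finset.sum_image (f := fun m => κ ^ m) hf, ← tsum_geometric_of_lt_one h0 h1]
    exact hs.sum_le_tsum _ fun _ _ => pow_nonneg h0 _
  rw [← Finset.sum_filter_add_sum_filter_not F (fun m => n ≤ m), two_mul]
  refine add_le_add (key _ _ ?_) (key _ _ ?_)
  · intro a ha b hb hab
    simp only [Finset.coe_filter, Set.mem_ofPred_eq] at ha hb hab
    omega
  · intro a ha b hb hab
    simp only [Finset.coe_filter, Set.mem_ofPred_eq] at ha hb hab
    omega

end SecondMoment

section Repeats

variable {A : Type*}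

/-- The sequences whose shifts by `l` and `n` agree along a word of length at most `N` whose
contraction ratio is below `ρ`. -/
def repeatEvent (r : A → ℝ) (ρ : ℝ) (N l n : ℕ) : Set (ℕ → A) :=
  {σ | ∃ k ≤ N, ∏ i ∈ Finset.range k, r (σ (l + i)) < ρ ∧ ∀ i < k, σ (l + i) = σ (n + i)}

lemma repeatEvent_comm (r : A → ℝ) (ρ : ℝ) (N l n : ℕ) :
    repeatEvent r ρ N l n = repeatEvent r ρ N n l := by
  have key : ∀ l n, repeatEvent r ρ N l n ⊆ repeatEvent r ρ N n l := by
    rintro l n σ ⟨k, hk, h1, h2⟩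
    refine ⟨k, hk, ?_, fun i hi => (h2 i hi).symm⟩
    rwa [Finset.prod_congr rfl fun i hi => by rw [← h2 i (Finset.mem_range.1 hi)]]
  exact (key l n).antisymm (key n l)

lemma repeatEvent_of_eqOn {r : A → ℝ} {ρ : ℝ} {N l n : ℕ} {S : Finset ℕ}
    (hl : ∀ i < N, l + i ∈ S) (hn : ∀ i < N, n + i ∈ S) {σ τ : ℕ → A}
    (h : ∀ i ∈ S, σ i = τ i) (hσ : σ ∈ repeatEvent r ρ N l n) : τ ∈ repeatEvent r ρ N l n := by
  obtain ⟨k, hk, h1, h2⟩ := hσ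
  refine ⟨k, hk, ?_, fun i hi => ?_⟩
  · rwa [Finset.prod_congr rfl fun i hi => by
      rw [← h _ (hl i ((Finset.mem_range.1 hi).trans_le hk))]]
  · rw [← h _ (hl i (hi.trans_le hk)), ← h _ (hn i (hi.trans_le hk)), h2 i hi]

lemma exists_cut {r : A → ℝ} {ρ : ℝ} {N : ℕ}
    (hN : ∀ c : ℕ → A, ∏ i ∈ Finset.range N, r (c i) < ρ) (c : ℕ → A) :
    ∃ k ≤ N, ∏ i ∈ Finset.range k, r (c i) < ρ ∧
      ∀ j < k, ρ ≤ ∏ i ∈ Finset.range j, r (c i) := by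
  classical
  have hex : ∃ k, ∏ i ∈ Finset.range k, r (c i) < ρ := ⟨N, hN c⟩
  exact ⟨Nat.find hex, Nat.find_min' hex (hN c), Nat.find_spec hex,
    fun j hj => not_lt.1 (Nat.find_min hex hj)⟩

lemma eq_of_mem_repeatEvent {r : A → ℝ} {ρ : ℝ} {N l n : ℕ} {S : Finset ℕ}
    (hl : ∀ i < N, l + i ∈ S) {c σ : ℕ → A} (hc : ∀ i ∈ S, σ i = c i) {k : ℕ}
    (hk : ∀ j < k, ρ ≤ ∏ i ∈ Finset.range j, r (c (l + i)))
    (hσ : σ ∈ repeatEvent r ρ N l n) {i : ℕ} (hi : i < k) : σ (n + i) = c (l + i) := by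
  obtain ⟨K, hK, h1, h2⟩ := hσ
  rw [Finset.prod_congr rfl fun i hi => by
    rw [hc _ (hl i ((Finset.mem_range.1 hi).trans_le hK))]] at h1
  have hkK : k ≤ K := not_lt.1 fun h => (hk K h).not_gt h1
  rw [← h2 i (hi.trans_le hkK), hc _ (hl i ((hi.trans_le hkK).trans_le hK))]

/-- The sequences with a repeat between the coordinate windows `[4N, 6N)` and `[6N, 8N)`. -/
def blockEvent (r : A → ℝ) (ρ : ℝ) (N : ℕ) : Set (ℕ → A) :=
  ⋃ q ∈ Finset.range N ×ˢ Finset.range N, repeatEvent r ρ N (4 * N + q.1) (6 * N + q.2)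

lemma blockEvent_of_eqOn {r : A → ℝ} {ρ : ℝ} {N : ℕ} {σ τ : ℕ → A}
    (h : ∀ i ∈ Finset.Ico (4 * N) (8 * N), σ i = τ i) (hσ : σ ∈ blockEvent r ρ N) :
    τ ∈ blockEvent r ρ N := by
  simp only [blockEvent, Set.mem_iUnion, exists_prop, Finset.mem_product, Finset.mem_range] at hσ ⊢
  obtain ⟨q, hq, hσ⟩ := hσ
  refine ⟨q, hq, repeatEvent_of_eqOn (fun i hi => ?_) (fun i hi => ?_) h hσ⟩ <;>
  · rw [Finset.mem_Ico]
    omega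

variable [Fintype A] [MeasurableSpace A] [MeasurableSingletonClass A] [Nonempty A]

lemma measureReal_repeatEvent_inter_le {r : A → ℝ} (hr : ∀ a, r a ∈ Set.Ioo (0 : ℝ) 1)
    {s : ℝ} (hs : 0 < s) (P : Measure (ℕ → A)) [IsProbabilityMeasure P]
    (hP : ∀ (S : Finset ℕ) (c : ℕ → A),
      P.real {σ | ∀ i ∈ S, σ i = c i} = ∏ i ∈ S, r (c i) ^ s)
    {ρ : ℝ} {N : ℕ} (hN : ∀ c : ℕ → A, ∏ i ∈ Finset.range N, r (c i) < ρ)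
    {lam : ℝ} (hlam : ∀ a, r a ^ s ≤ lam)
    (S : Finset ℕ) {l l' n n' : ℕ} (hl : ∀ i < N, l + i ∈ S) (hl' : ∀ i < N, l' + i ∈ S)
    (hn : ∀ i < N, n + i ∉ S) (hn' : ∀ i < N, n' + i ∉ S) (hnn : n ≤ n') :
    P.real (repeatEvent r ρ N l n ∩ repeatEvent r ρ N l' n') ≤
      ρ ^ s * (ρ ^ s + lam ^ (n' - n)) := by
  classical
  refine measureReal_le_of_forall_coords P S fun c => ?_
  have hp0 : ∀ a, 0 < r a ^ s := fun a => Real.rpow_pos_of_pos (hr a).1 s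
  have hcut : ∀ (w : ℕ → A) (k : ℕ), ∏ i ∈ Finset.range k, r (w i) < ρ →
      ∏ i ∈ Finset.range k, r (w i) ^ s ≤ ρ ^ s := by
    intro w k hk
    rw [Real.finsetProd_rpow _ _ fun i _ => (hr _).1.le]
    exact Real.rpow_le_rpow (Finset.prod_nonneg fun i _ => (hr _).1.le) hk.le hs.le
  have hρ : 0 ≤ ρ := (Finset.prod_nonneg fun i _ => (hr (c i)).1.le).trans (hN c).le
  have hlam0 : 0 ≤ lam := (hp0 (c 0)).le.trans (hlam _)
  obtain ⟨k, hkN, hk, hkmin⟩ := exists_cut hN (fun i => c (l + i))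
  obtain ⟨k', hkN', hk', hkmin'⟩ := exists_cut hN (fun i => c (l' + i))
  set m := min k (n' - n) with hm
  have hmk : m ≤ k := min_le_left _ _
  have hmn : m ≤ n' - n := min_le_right _ _
  set T := Finset.Ico n (n + m) with hT
  set T' := Finset.Ico n' (n' + k') with hT'
  set d : ℕ → A := fun i =>
    if i ∈ S then c i else if i < n' then c (l + (i - n)) else c (l' + (i - n')) with hd
  have hTd : ∀ i < m, d (n + i) = c (l + i) := by
    intro i hi
    have h1 : n + i ∉ S := hn i (by omega)
    have h2 : n + i < n' := by omega
    simp only [hd, if_neg h1, if_pos h2]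
    congr 2
    omega
  have hTd' : ∀ i < k', d (n' + i) = c (l' + i) := by
    intro i hi
    have h1 : n' + i ∉ S := hn' i (by omega)
    have h2 : ¬ n' + i < n' := by omega
    simp only [hd, if_neg h1, if_neg h2]
    congr 2
    omega
  have hdisj' : Disjoint T T' := by
    rw [Finset.disjoint_left]
    intro i hi hi'
    simp only [hT, hT', Finset.mem_Ico] at hi hi'
    omega
  have hdisj : Disjoint S (T ∪ T') := by
    rw [Finset.disjoint_left]
    intro i hi hi'
    rw [Finset.mem_union, hT, hT', Finset.mem_Ico, Finset.mem_Ico] at hi'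
    rcases hi' with h | h
    · exact hn (i - n) (by omega) (by rwa [show n + (i - n) = i by omega])
    · exact hn' (i - n') (by omega) (by rwa [show n' + (i - n') = i by omega])
  have hsub : (repeatEvent r ρ N l n ∩ repeatEvent r ρ N l' n') ∩ {σ | ∀ i ∈ S, σ i = c i} ⊆
      {σ | ∀ i ∈ S ∪ (T ∪ T'), σ i = d i} := by
    rintro σ ⟨⟨hσ, hσ'⟩, hc⟩ i hi
    rw [Finset.mem_union, Finset.mem_union, hT, hT', Finset.mem_Ico, Finset.mem_Ico] at hi
    rcases hi with hi | hi | hi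
    · simp only [hd, if_pos hi]
      exact hc i hi
    · obtain ⟨j, rfl⟩ := Nat.exists_eq_add_of_le hi.1
      rw [hTd j (by omega)]
      exact eq_of_mem_repeatEvent hl hc hkmin hσ (by omega)
    · obtain ⟨j, rfl⟩ := Nat.exists_eq_add_of_le hi.1
      rw [hTd' j (by omega)]
      exact eq_of_mem_repeatEvent hl' hc hkmin' hσ' (by omega)
  refine (measureReal_mono hsub).trans ?_
  rw [hP, hP, Finset.prod_union hdisj, Finset.prod_union hdisj', mul_comm]
  have hSd : ∏ i ∈ S, r (d i) ^ s = ∏ i ∈ S, r (c i) ^ s :=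
    Finset.prod_congr rfl fun i hi => by simp only [hd, if_pos hi]
  rw [hSd]
  refine mul_le_mul_of_nonneg_right ?_ (Finset.prod_nonneg fun i _ => (hp0 _).le)
  rw [mul_comm (ρ ^ s)]
  refine mul_le_mul ?_ ?_ (Finset.prod_nonneg fun i _ => (hp0 _).le)
    (add_nonneg (Real.rpow_nonneg hρ s) (pow_nonneg hlam0 _))
  · rw [hT, Finset.prod_Ico_eq_prod_range, Nat.add_sub_cancel_left,
      Finset.prod_congr rfl fun i hi => by rw [hTd i (Finset.mem_range.1 hi)]]
    rcases min_cases k (n' - n) with ⟨h, -⟩ | ⟨h, -⟩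
    · rw [hm, h]
      exact (hcut (fun i => c (l + i)) k hk).trans (le_add_of_nonneg_right (pow_nonneg hlam0 _))
    · rw [hm, h]
      refine le_trans ?_ (le_add_of_nonneg_left (Real.rpow_nonneg hρ s))
      calc _ ≤ ∏ _i ∈ Finset.range (n' - n), lam :=
            Finset.prod_le_prod (fun i _ => (hp0 _).le) fun i _ => hlam _
        _ = _ := by simp
  · rw [hT', Finset.prod_Ico_eq_prod_range, Nat.add_sub_cancel_left,
      Finset.prod_congr rfl fun i hi => by rw [hTd' i (Finset.mem_range.1 hi)]]
    exact hcut (fun i => c (l' + i)) k' hk'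

lemma le_measureReal_repeatEvent {r : A → ℝ} (hr : ∀ a, r a ∈ Set.Ioo (0 : ℝ) 1)
    {s : ℝ} (hs : 0 < s) (P : Measure (ℕ → A)) [IsProbabilityMeasure P]
    (hP : ∀ (S : Finset ℕ) (c : ℕ → A),
      P.real {σ | ∀ i ∈ S, σ i = c i} = ∏ i ∈ S, r (c i) ^ s)
    {ρ : ℝ} (hρ0 : 0 ≤ ρ) (hρ1 : ρ ≤ 1) {N : ℕ}
    (hN : ∀ c : ℕ → A, ∏ i ∈ Finset.range N, r (c i) < ρ)
    {p₀ : ℝ} (hp₀ : 0 ≤ p₀) (hp : ∀ a, p₀ ≤ r a ^ s)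
    (S : Finset ℕ) {l n : ℕ} (hl : ∀ i < N, l + i ∈ S) (hn : ∀ i < N, n + i ∉ S) :
    p₀ * ρ ^ s ≤ P.real (repeatEvent r ρ N l n) := by
  classical
  refine le_measureReal_of_forall_coords P S fun c => ?_
  have hp0 : ∀ a, 0 < r a ^ s := fun a => Real.rpow_pos_of_pos (hr a).1 s
  obtain ⟨k, hkN, hk, hkmin⟩ := exists_cut hN (fun i => c (l + i))
  set T := Finset.Ico n (n + k) with hT
  set d : ℕ → A := fun i => if i ∈ S then c i else c (l + (i - n)) with hd
  have hTd : ∀ i < k, d (n + i) = c (l + i) := by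
    intro i hi
    simp only [hd, if_neg (hn i (by omega))]
    congr 2
    omega
  have hdisj : Disjoint S T := by
    rw [Finset.disjoint_left]
    intro i hi hi'
    rw [hT, Finset.mem_Ico] at hi'
    exact hn (i - n) (by omega) (by rwa [show n + (i - n) = i by omega])
  have hsub : {σ | ∀ i ∈ S ∪ T, σ i = d i} ⊆
      repeatEvent r ρ N l n ∩ {σ | ∀ i ∈ S, σ i = c i} := by
    intro σ hσ
    have hσS : ∀ i ∈ S, σ i = c i := fun i hi => by
      rw [hσ i (Finset.mem_union_left _ hi)]
      simp only [hd, if_pos hi]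
    refine ⟨⟨k, hkN, ?_, fun i hi => ?_⟩, hσS⟩
    · rwa [Finset.prod_congr rfl fun i hi => by
        rw [hσS _ (hl i ((Finset.mem_range.1 hi).trans_le hkN))]]
    · rw [hσS _ (hl i (hi.trans_le hkN)), hσ (n + i) (Finset.mem_union_right _ ?_), hTd i hi]
      rw [hT, Finset.mem_Ico]
      omega
  refine le_trans ?_ (measureReal_mono hsub)
  rw [hP, hP, Finset.prod_union hdisj, mul_comm]
  have hSd : ∏ i ∈ S, r (d i) ^ s = ∏ i ∈ S, r (c i) ^ s :=
    Finset.prod_congr rfl fun i hi => by simp only [hd, if_pos hi]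
  rw [hSd]
  refine mul_le_mul_of_nonneg_left ?_ (Finset.prod_nonneg fun i _ => (hp0 _).le)
  rw [hT, Finset.prod_Ico_eq_prod_range, Nat.add_sub_cancel_left,
    Finset.prod_congr rfl fun i hi => by rw [hTd i (Finset.mem_range.1 hi)]]
  obtain _ | k := k
  · simp only [Finset.range_zero, Finset.prod_empty] at hk
    exact absurd hk hρ1.not_gt
  · rw [Finset.prod_range_succ, mul_comm]
    refine mul_le_mul ?_ (hp _) hp₀ (Finset.prod_nonneg fun i _ => (hp0 _).le)
    rw [Real.finsetProd_rpow _ _ fun i _ => (hr _).1.le]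
    exact Real.rpow_le_rpow hρ0 (hkmin k k.lt_succ_self) hs.le

lemma le_measureReal_blockEvent {r : A → ℝ} (hr : ∀ a, r a ∈ Set.Ioo (0 : ℝ) 1)
    {s : ℝ} (hs : 0 < s) (P : Measure (ℕ → A)) [IsProbabilityMeasure P]
    (hP : ∀ (S : Finset ℕ) (c : ℕ → A),
      P.real {σ | ∀ i ∈ S, σ i = c i} = ∏ i ∈ S, r (c i) ^ s)
    {ρ : ℝ} (hρ0 : 0 < ρ) (hρ1 : ρ ≤ 1) {N : ℕ} (hN0 : 0 < N)
    (hN : ∀ c : ℕ → A, ∏ i ∈ Finset.range N, r (c i) < ρ)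
    {p₀ : ℝ} (hp₀ : 0 ≤ p₀) (hp : ∀ a, p₀ ≤ r a ^ s)
    {κ : ℝ} (hκ0 : 0 ≤ κ) (hκ1 : κ < 1) (hκ : ∀ a, r a ^ s ≤ κ ^ 2) :
    p₀ ^ 2 * ((N : ℝ) ^ 2 * ρ ^ s / ((N : ℝ) ^ 2 * ρ ^ s + (2 * (1 - κ)⁻¹) ^ 2)) ≤
      P.real (blockEvent r ρ N) := by
  classical
  set δ := ρ ^ s with hδ
  have hδ0 : 0 < δ := Real.rpow_pos_of_pos hρ0 s
  set C := 2 * (1 - κ)⁻¹ with hC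
  set Q := Finset.range N ×ˢ Finset.range N with hQ
  set E : ℕ × ℕ → Set (ℕ → A) :=
    fun q => repeatEvent r ρ N (4 * N + q.1) (6 * N + q.2) with hE
  have hEm : ∀ q, MeasurableSet (E q) := by
    intro q
    refine measurableSet_of_dependsOn (Finset.range (8 * N + q.1 + q.2)) fun σ τ h hσ =>
      repeatEvent_of_eqOn (fun i hi => ?_) (fun i hi => ?_) h hσ <;>
    · rw [Finset.mem_range]
      omega
  have hlow : ∀ q ∈ Q, p₀ * δ ≤ P.real (E q) := by
    intro q hq
    rw [hQ, Finset.mem_product, Finset.mem_range, Finset.mem_range] at hq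
    refine le_measureReal_repeatEvent hr hs P hP hρ0.le hρ1 hN hp₀ hp
      (Finset.Ico (4 * N) (6 * N)) (fun i hi => ?_) (fun i hi => ?_) <;>
    · rw [Finset.mem_Ico]
      omega
  have hy : ∀ q ∈ Q, ∀ q' ∈ Q, q.2 ≤ q'.2 →
      P.real (E q ∩ E q') ≤ δ * (δ + (κ ^ 2) ^ ((q'.2 - q.2) + (q.2 - q'.2))) := by
    intro q hq q' hq' hle
    rw [hQ, Finset.mem_product, Finset.mem_range, Finset.mem_range] at hq hq'
    have := measureReal_repeatEvent_inter_le hr hs P hP hN hκ (Finset.Ico (4 * N) (6 * N))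
      (l := 4 * N + q.1) (l' := 4 * N + q'.1) (n := 6 * N + q.2) (n' := 6 * N + q'.2)
      (fun i hi => by rw [Finset.mem_Ico]; omega) (fun i hi => by rw [Finset.mem_Ico]; omega)
      (fun i hi => by rw [Finset.mem_Ico]; omega) (fun i hi => by rw [Finset.mem_Ico]; omega)
      (by omega)
    rwa [show 6 * N + q'.2 - (6 * N + q.2) = (q'.2 - q.2) + (q.2 - q'.2) by omega] at this
  have hx : ∀ q ∈ Q, ∀ q' ∈ Q, q.1 ≤ q'.1 →
      P.real (E q ∩ E q') ≤ δ * (δ + (κ ^ 2) ^ ((q'.1 - q.1) + (q.1 - q'.1))) := by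
    intro q hq q' hq' hle
    rw [hQ, Finset.mem_product, Finset.mem_range, Finset.mem_range] at hq hq'
    have := measureReal_repeatEvent_inter_le hr hs P hP hN hκ (Finset.Ico (6 * N) (8 * N))
      (l := 6 * N + q.2) (l' := 6 * N + q'.2) (n := 4 * N + q.1) (n' := 4 * N + q'.1)
      (fun i hi => by rw [Finset.mem_Ico]; omega) (fun i hi => by rw [Finset.mem_Ico]; omega)
      (fun i hi => by rw [Finset.mem_Ico]; omega) (fun i hi => by rw [Finset.mem_Ico]; omega)
      (by omega)
    rw [repeatEvent_comm r ρ N (6 * N + q.2), repeatEvent_comm r ρ N (6 * N + q'.2)] at this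
    rwa [show 4 * N + q'.1 - (4 * N + q.1) = (q'.1 - q.1) + (q.1 - q'.1) by omega] at this
  have hpair : ∀ q ∈ Q, ∀ q' ∈ Q, P.real (E q ∩ E q') ≤
      δ ^ 2 + δ * (κ ^ ((q'.1 - q.1) + (q.1 - q'.1)) * κ ^ ((q'.2 - q.2) + (q.2 - q'.2))) := by
    intro q hq q' hq'
    have h1 : P.real (E q ∩ E q') ≤ δ * (δ + (κ ^ 2) ^ ((q'.1 - q.1) + (q.1 - q'.1))) := by
      rcases le_total q.1 q'.1 with h | h
      · exact hx q hq q' hq' h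
      · rw [Set.inter_comm, add_comm (q'.1 - q.1)]
        exact hx q' hq' q hq h
    have h2 : P.real (E q ∩ E q') ≤ δ * (δ + (κ ^ 2) ^ ((q'.2 - q.2) + (q.2 - q'.2))) := by
      rcases le_total q.2 q'.2 with h | h
      · exact hy q hq q' hq' h
      · rw [Set.inter_comm, add_comm (q'.2 - q.2)]
        exact hy q' hq' q hq h
    generalize (q'.1 - q.1) + (q.1 - q'.1) = a at h1 ⊢
    generalize (q'.2 - q.2) + (q.2 - q'.2) = b at h2 ⊢
    rw [← pow_add, sq δ, ← mul_add]
    rcases le_total a b with h | h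
    · refine h2.trans (mul_le_mul_of_nonneg_left (add_le_add_right ?_ _) hδ0.le)
      rw [← pow_mul]
      exact pow_le_pow_of_le_one hκ0 hκ1.le (by omega)
    · refine h1.trans (mul_le_mul_of_nonneg_left (add_le_add_right ?_ _) hδ0.le)
      rw [← pow_mul]
      exact pow_le_pow_of_le_one hκ0 hκ1.le (by omega)
  have hC0 : 0 < C := mul_pos two_pos (inv_pos.2 (sub_pos.2 hκ1))
  set t := (N : ℝ) ^ 2 * δ with ht
  have ht0 : 0 < t := by positivity
  have hcard : (Q.card : ℝ) = (N : ℝ) ^ 2 := by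
    rw [hQ, Finset.card_product, Finset.card_range]
    push_cast
    ring
  have hfirst : p₀ * t ≤ ∑ q ∈ Q, P.real (E q) := by
    have := Finset.card_nsmul_le_sum Q _ _ hlow
    rw [nsmul_eq_mul, hcard] at this
    linarith
  have hsecond : ∑ q ∈ Q, ∑ q' ∈ Q, P.real (E q ∩ E q') ≤ t ^ 2 + C ^ 2 * t := by
    have hrow : ∀ q ∈ Q, ∑ q' ∈ Q, P.real (E q ∩ E q') ≤ (N : ℝ) ^ 2 * δ ^ 2 + δ * C ^ 2 := by
      intro q hq
      refine (Finset.sum_le_sum (hpair q hq)).trans ?_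
      rw [Finset.sum_add_distrib, Finset.sum_const, nsmul_eq_mul, hcard, ← Finset.mul_sum, hQ,
        ← Finset.sum_mul_sum (Finset.range N) (Finset.range N)
          (fun m => κ ^ ((m - q.1) + (q.1 - m))) (fun m => κ ^ ((m - q.2) + (q.2 - m))) |>.trans
          (Finset.sum_product' _ _ _).symm, sq C]
      refine add_le_add_right (mul_le_mul_of_nonneg_left (mul_le_mul ?_ ?_ ?_ hC0.le) hδ0.le) _
      · exact sum_pow_sub_add_sub_le hκ0 hκ1 _ _
      · exact sum_pow_sub_add_sub_le hκ0 hκ1 _ _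
      · exact Finset.sum_nonneg fun _ _ => pow_nonneg hκ0 _
    have := Finset.sum_le_card_nsmul Q _ _ hrow
    rw [nsmul_eq_mul, hcard] at this
    refine this.trans (le_of_eq ?_)
    rw [ht]
    ring
  have hCE := sq_sum_measureReal_le P Q E hEm
  change _ ≤ P.real (⋃ q ∈ Q, E q)
  rw [← mul_div_assoc, div_le_iff₀ (by positivity)]
  refine le_of_mul_le_mul_right ?_ ht0
  calc p₀ ^ 2 * t * t = (p₀ * t) ^ 2 := by ring
    _ ≤ (∑ q ∈ Q, P.real (E q)) ^ 2 := pow_le_pow_left₀ (by positivity) hfirst 2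
    _ ≤ _ := hCE
    _ ≤ P.real (⋃ q ∈ Q, E q) * (t ^ 2 + C ^ 2 * t) :=
        mul_le_mul_of_nonneg_left hsecond measureReal_nonneg
    _ = _ := by ring

end Repeats

lemma summable_of_summable_div_add {t : ℕ → ℝ} (ht : ∀ i, 0 ≤ t i) {D : ℝ} (hD : 0 < D)
    (h : Summable fun i => t i / (t i + D)) : Summable t := by
  have hev : ∀ᶠ i in atTop, t i / (t i + D) < 1 / 2 :=
    h.tendsto_atTop_zero.eventually (gt_mem_nhds (by norm_num))
  have h2 : Summable fun i => (2 * D) * (t i / (t i + D)) := h.mul_left _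
  refine Summable.of_norm_bounded_eventually_nat h2 ?_
  filter_upwards [hev] with i hi
  have hpos : 0 < t i + D := by linarith [ht i]
  rw [div_lt_div_iff₀ hpos two_pos] at hi
  rw [Real.norm_of_nonneg (ht i), ← mul_div_assoc, le_div_iff₀ hpos]
  nlinarith [ht i]

lemma ae_frequently_mem_blockEvent {A : Type*} [Fintype A] [MeasurableSpace A]
    [MeasurableSingletonClass A] [Nonempty A] {r : A → ℝ} (hr : ∀ a, r a ∈ Set.Ioo (0 : ℝ) 1)
    {s : ℝ} (hs : 0 < s) (P : Measure (ℕ → A)) [IsProbabilityMeasure P]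
    (hP : ∀ (n : ℕ) (a : Fin n → A), P (cyl a) = ENNReal.ofReal (∏ i, r (a i) ^ s))
    (ρ : ℕ → ℝ) (hρ0 : ∀ i, 0 ≤ ρ i) (hρ1 : ∀ i, ρ i ≤ 1)
    (hdiv : ¬ Summable fun i : ℕ => (4 : ℝ) ^ i * ρ i ^ s) :
    ∀ᵐ σ ∂P, ∃ᶠ i in atTop, σ ∈ blockEvent r (ρ i) (2 ^ i) := by
  classical
  have hp0 : ∀ a, 0 < r a ^ s := fun a => Real.rpow_pos_of_pos (hr a).1 s
  have hp1 : ∀ a, r a ^ s < 1 := fun a => Real.rpow_lt_one (hr a).1.le (hr a).2 hs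
  obtain ⟨a₀, ha₀⟩ := Finite.exists_min fun a => r a ^ s
  obtain ⟨a₁, ha₁⟩ := Finite.exists_max fun a => r a ^ s
  set lam := r a₁ ^ s with hlam
  set κ := √lam with hκ
  have hκ2 : κ ^ 2 = lam := Real.sq_sqrt (hp0 a₁).le
  have hκ0 : 0 ≤ κ := Real.sqrt_nonneg _
  have hκ1 : κ < 1 := by
    rw [hκ, Real.sqrt_lt' one_pos, one_pow]
    exact hp1 a₁
  have hcoord := measureReal_coords_of_cyl (fun a => (hp0 a).le) P hP
  have hind := iIndep_coords_of_cyl (fun a => (hp0 a).le) P hP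
  let good : ℕ → Prop := fun i => ∀ c : ℕ → A, ∏ j ∈ Finset.range (2 ^ i), r (c j) < ρ i
  set F : ℕ → Set (ℕ → A) := fun i => if good i then blockEvent r (ρ i) (2 ^ i) else ∅ with hF
  set B : ℕ → Finset ℕ := fun i => Finset.Ico (4 * 2 ^ i) (8 * 2 ^ i) with hBdef
  have hFdep : ∀ j, ∀ σ τ : ℕ → A, (∀ i ∈ B j, σ i = τ i) → σ ∈ F j → τ ∈ F j := by
    intro j σ τ h hσ
    by_cases hg : good j
    · simp only [hF, if_pos hg] at hσ ⊢
      exact blockEvent_of_eqOn h hσ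
    · simp only [hF, if_neg hg] at hσ
      exact hσ.elim
  have hB : Pairwise fun i j => Disjoint (B i) (B j) := by
    have key : ∀ i j, i < j → Disjoint (B i) (B j) := by
      intro i j hij
      rw [Finset.disjoint_left]
      intro k hk hk'
      rw [hBdef, Finset.mem_Ico] at hk hk'
      have : 2 ^ (i + 1) ≤ 2 ^ j := Nat.pow_le_pow_right two_pos hij
      rw [pow_succ] at this
      omega
    intro i j hij
    rcases lt_or_gt_of_ne hij with h | h
    · exact key i j h
    · exact (key j i h).symm
  have hindF := iIndepSet_of_dependsOn hind B hB F hFdep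
  have hFm : ∀ i, MeasurableSet (F i) := fun i => measurableSet_of_dependsOn (B i) (hFdep i)
  have htsum : ∑' i, P (F i) = ⊤ := by
    by_contra hne
    have hsum : Summable fun i => P.real (F i) := ENNReal.summable_toReal hne
    set t : ℕ → ℝ := fun i => if good i then (4 : ℝ) ^ i * ρ i ^ s else 0 with ht
    have ht0 : ∀ i, 0 ≤ t i := by
      intro i
      simp only [ht]
      split_ifs
      · exact mul_nonneg (by positivity) (Real.rpow_nonneg (hρ0 i) s)
      · exact le_rfl
    have hD : 0 < (2 * (1 - κ)⁻¹) ^ 2 := by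
      have : 0 < 1 - κ := sub_pos.2 hκ1
      positivity
    have hts : Summable t := by
      refine summable_of_summable_div_add ht0 hD ?_
      refine Summable.of_nonneg_of_le (fun i => div_nonneg (ht0 i) (add_nonneg (ht0 i) hD.le))
        (fun i => ?_) (hsum.mul_left ((r a₀ ^ s) ^ 2)⁻¹)
      rw [← div_eq_inv_mul, le_div_iff₀' (pow_pos (hp0 a₀) 2)]
      by_cases hg : good i
      · simp only [ht, hF, if_pos hg]
        have hρpos : 0 < ρ i := lt_of_le_of_lt
          (Finset.prod_nonneg fun j _ => (hr a₀).1.le) (hg fun _ => a₀)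
        have := le_measureReal_blockEvent hr hs P hcoord hρpos (hρ1 i) (pow_pos two_pos i) hg
          (hp0 a₀).le ha₀ hκ0 hκ1 (fun a => (ha₁ a).trans_eq hκ2.symm)
        have h4 : ((2 ^ i : ℕ) : ℝ) ^ 2 = 4 ^ i := by
          push_cast
          rw [← pow_mul, mul_comm i 2, pow_mul]
          norm_num
        rwa [h4] at this
      · simp [ht, hg, measureReal_nonneg]
    have hbad : Summable fun i : ℕ => ((2 ^ i : ℕ) : ℝ) ^ 2 * lam ^ (2 ^ i) :=
      (summable_pow_mul_geometric_of_norm_lt_one 2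
        (by rw [Real.norm_of_nonneg (hp0 a₁).le]; exact hp1 a₁ : ‖lam‖ < 1)).comp_injective
        (Nat.pow_right_injective le_rfl)
    refine hdiv (Summable.of_nonneg_of_le
      (fun i => mul_nonneg (by positivity) (Real.rpow_nonneg (hρ0 i) s)) (fun i => ?_)
      (hts.add hbad))
    by_cases hg : good i
    · simp only [ht, if_pos hg]
      have : 0 ≤ lam := (hp0 a₁).le
      exact le_add_of_nonneg_right (by positivity)
    · simp only [ht, if_neg hg, zero_add]
      simp only [good, not_forall, not_lt] at hg
      obtain ⟨c, hc⟩ := hg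
      have h4 : ((2 ^ i : ℕ) : ℝ) ^ 2 = 4 ^ i := by
        push_cast
        rw [← pow_mul, mul_comm i 2, pow_mul]
        norm_num
      rw [h4]
      refine mul_le_mul_of_nonneg_left ?_ (by positivity)
      calc ρ i ^ s ≤ (∏ j ∈ Finset.range (2 ^ i), r (c j)) ^ s :=
            Real.rpow_le_rpow (hρ0 i) hc hs.le
        _ = ∏ j ∈ Finset.range (2 ^ i), r (c j) ^ s :=
            (Real.finsetProd_rpow _ _ (fun j _ => (hr _).1.le) _).symm
        _ ≤ ∏ _j ∈ Finset.range (2 ^ i), lam :=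
            Finset.prod_le_prod (fun j _ => (hp0 _).le) fun j _ => ha₁ _
        _ = lam ^ (2 ^ i) := by simp
  have hone := ProbabilityTheory.measure_limsup_eq_one hFm hindF htsum
  have hae : ∀ᵐ σ ∂P, σ ∈ limsup F atTop := by
    rw [← prob_compl_eq_zero_iff (MeasurableSet.measurableSet_limsup hFm)] at hone
    exact hone
  filter_upwards [hae] with σ hσ
  rw [Filter.mem_limsup_iff_frequently_mem] at hσ
  refine hσ.mono fun i hi => ?_
  by_cases hg : good i
  · simpa only [hF, if_pos hg] using hi
  · simp only [hF, if_neg hg] at hi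
    exact hi.elim

section Series

lemma sum_Ico_two_pow_le {h : ℕ → ℝ} (h0 : ∀ n, 0 ≤ h n)
    (hanti : ∀ m n, 1 ≤ m → m ≤ n → h n ≤ h m) (k : ℕ) :
    ∑ n ∈ (Finset.Ico 1 (2 ^ k) : Finset ℕ), (n : ℝ) * h n ≤
      ∑ i ∈ Finset.range k, 2 * ((4 : ℝ) ^ i * h (2 ^ i)) := by
  induction k with
  | zero => simp
  | succ k ih =>
    have h1 : 1 ≤ 2 ^ k := Nat.one_le_two_pow
    have h2 : 2 ^ k ≤ 2 ^ (k + 1) := Nat.pow_le_pow_right two_pos k.le_succ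
    rw [← Finset.sum_Ico_consecutive _ h1 h2, Finset.sum_range_succ]
    refine add_le_add ih ?_
    have hb : ∀ n ∈ (Finset.Ico (2 ^ k) (2 ^ (k + 1)) : Finset ℕ),
        (n : ℝ) * h n ≤ (2 : ℝ) ^ (k + 1) * h (2 ^ k) := by
      intro n hn
      rw [Finset.mem_Ico] at hn
      refine mul_le_mul ?_ (hanti _ _ h1 hn.1) (h0 _) (by positivity)
      exact_mod_cast hn.2.le
    have := Finset.sum_le_card_nsmul _ _ _ hb
    rw [Nat.card_Ico, show 2 ^ (k + 1) - 2 ^ k = 2 ^ k by rw [pow_succ]; omega,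
      nsmul_eq_mul] at this
    refine this.trans (le_of_eq ?_)
    rw [show (4 : ℝ) = 2 * 2 by norm_num, mul_pow]
    push_cast
    ring

lemma summable_mul_of_summable_condensed {h : ℕ → ℝ} (h0 : ∀ n, 0 ≤ h n)
    (hanti : ∀ m n, 1 ≤ m → m ≤ n → h n ≤ h m)
    (hs : Summable fun i : ℕ => (4 : ℝ) ^ i * h (2 ^ i)) :
    Summable fun n : ℕ => (n : ℝ) * h n := by
  have hnn : ∀ n : ℕ, 0 ≤ (n : ℝ) * h n := fun n => mul_nonneg n.cast_nonneg (h0 n)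
  have hs2 := hs.mul_left 2
  refine summable_of_sum_range_le (c := ∑' i, 2 * ((4 : ℝ) ^ i * h (2 ^ i))) hnn fun n => ?_
  have hn : n ≤ 2 ^ n := Nat.lt_two_pow_self.le
  calc ∑ i ∈ Finset.range n, (i : ℝ) * h i ≤ ∑ i ∈ Finset.range (2 ^ n), (i : ℝ) * h i :=
        Finset.sum_le_sum_of_subset_of_nonneg (Finset.range_subset_range.2 hn)
          fun i _ _ => hnn i
    _ = ∑ i ∈ (Finset.Ico 1 (2 ^ n) : Finset ℕ), (i : ℝ) * h i := by
        rw [Finset.range_eq_Ico, Finset.sum_eq_sum_Ico_succ_bot (Nat.two_pow_pos n)]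
        simp
    _ ≤ _ := sum_Ico_two_pow_le h0 hanti n
    _ ≤ _ := hs2.sum_le_tsum _ fun i _ => mul_nonneg two_pos.le
        (mul_nonneg (by positivity) (h0 _))

lemma not_summable_condensed_min {g : ℕ → ℝ} (hg0 : ∀ n, 0 ≤ g n)
    (hganti : ∀ n, 1 ≤ n → g (n + 1) ≤ g n) {s : ℝ} (hs : 0 < s)
    (hdiv : ¬ Summable fun n : ℕ => (n : ℝ) * g n ^ s) :
    ¬ Summable fun i : ℕ => (4 : ℝ) ^ i * min (g (2 ^ (i + 3))) 1 ^ s := by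
  intro hsum
  refine hdiv (summable_mul_of_summable_condensed (h := fun n => g n ^ s)
    (fun n => Real.rpow_nonneg (hg0 n) s) (fun m n hm hmn => ?_) ?_)
  · refine Real.rpow_le_rpow (hg0 n) ?_ hs.le
    induction n, hmn using Nat.le_induction with
    | base => exact le_rfl
    | succ k hk ih => exact (hganti k (hm.trans hk)).trans ih
  · rw [← summable_nat_add_iff 3]
    refine Summable.of_norm_bounded_eventually_nat (hsum.mul_left 64) ?_
    filter_upwards [hsum.tendsto_atTop_zero.eventually (gt_mem_nhds one_pos)] with i hi
    have hlt : g (2 ^ (i + 3)) < 1 := by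
      by_contra hge
      rw [min_eq_right (not_lt.1 hge), Real.one_rpow, mul_one] at hi
      exact hi.not_ge (one_le_pow₀ (by norm_num))
    rw [min_eq_left hlt.le, Real.norm_of_nonneg
      (mul_nonneg (by positivity) (Real.rpow_nonneg (hg0 _) s)), pow_add]
    apply le_of_eq
    ring

end Series

section Coding

variable {A : Type*} {d : ℕ} {φ : A → EuclideanSpace ℝ (Fin d) → EuclideanSpace ℝ (Fin d)}
  {r : A → ℝ} {X : Set (EuclideanSpace ℝ (Fin d))}
  {π : (ℕ → A) → EuclideanSpace ℝ (Fin d)}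

lemma norm_iterMap_sub (hsim : ∀ a x y, ‖φ a x - φ a y‖ = r a * ‖x - y‖) {n : ℕ}
    (w : Fin n → A) (x y : EuclideanSpace ℝ (Fin d)) :
    ‖iterMap φ w x - iterMap φ w y‖ = (∏ i, r (w i)) * ‖x - y‖ := by
  induction n with
  | zero => simp [iterMap]
  | succ n ih =>
    have h : ∀ z, iterMap φ w z = φ (w 0) (iterMap φ (fun i : Fin n => w i.succ) z) := by
      intro z
      simp [iterMap, List.ofFn_succ]
    rw [h, h, hsim, ih, Fin.prod_univ_succ, mul_assoc]

lemma diam_iterMap_image (hr : ∀ a, r a ∈ Set.Ioo (0 : ℝ) 1)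
    (hsim : ∀ a x y, ‖φ a x - φ a y‖ = r a * ‖x - y‖) (hX : IsCompact X) {n : ℕ}
    (w : Fin n → A) : Metric.diam (iterMap φ w '' X) = (∏ i, r (w i)) * Metric.diam X := by
  have hR : 0 < ∏ i, r (w i) := Finset.prod_pos fun i _ => (hr _).1
  have hbdd : Bornology.IsBounded (iterMap φ w '' X) := by
    refine LipschitzWith.isBounded_image
      (LipschitzWith.of_dist_le_mul (K := (∏ i, r (w i)).toNNReal) fun x y => ?_) hX.isBounded
    rw [dist_eq_norm, dist_eq_norm, norm_iterMap_sub hsim, Real.coe_toNNReal _ hR.le]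
  refine le_antisymm ?_ ?_
  · refine Metric.diam_le_of_forall_dist_le (mul_nonneg hR.le Metric.diam_nonneg) ?_
    rintro _ ⟨x, hx, rfl⟩ _ ⟨y, hy, rfl⟩
    rw [dist_eq_norm, norm_iterMap_sub hsim, ← dist_eq_norm]
    exact mul_le_mul_of_nonneg_left (Metric.dist_le_diam_of_mem hX.isBounded hx hy) hR.le
  · rw [← le_div_iff₀' hR]
    refine Metric.diam_le_of_forall_dist_le (div_nonneg Metric.diam_nonneg hR.le) ?_
    intro x hx y hy
    rw [le_div_iff₀' hR, dist_eq_norm, ← norm_iterMap_sub hsim, ← dist_eq_norm]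
    exact Metric.dist_le_diam_of_mem hbdd (Set.mem_image_of_mem _ hx) (Set.mem_image_of_mem _ hy)

/-- Sequences with a common prefix of length `n` have close images under the coding map. -/
lemma norm_coding_sub_le (hsim : ∀ a x y, ‖φ a x - φ a y‖ = r a * ‖x - y‖)
    (hr : ∀ a, r a ∈ Set.Ioo (0 : ℝ) 1) (hX : IsCompact X)
    (hπ : ∀ (σ : ℕ → A) (n : ℕ), π σ ∈ iterMap φ (fun i : Fin n => σ i) '' X)
    {σ τ : ℕ → A} {n : ℕ} (h : ∀ i < n, σ i = τ i) :
    ‖π σ - π τ‖ ≤ (∏ i ∈ Finset.range n, r (σ i)) * Metric.diam X := by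
  have heq : (fun i : Fin n => τ i) = fun i : Fin n => σ i := funext fun i => (h i i.2).symm
  obtain ⟨x, hx, hxσ⟩ := hπ σ n
  obtain ⟨y, hy, hyτ⟩ := hπ τ n
  rw [heq] at hyτ
  rw [← hxσ, ← hyτ, norm_iterMap_sub hsim, Fin.prod_univ_eq_prod_range (fun i => r (σ i)) n,
    ← dist_eq_norm]
  exact mul_le_mul_of_nonneg_left (Metric.dist_le_diam_of_mem hX.isBounded hx hy)
    (Finset.prod_nonneg fun i _ => (hr _).1.le)

lemma measurable_coding [Finite A] [MeasurableSpace A] [MeasurableSingletonClass A] [Nonempty A]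
    (hr : ∀ a, r a ∈ Set.Ioo (0 : ℝ) 1)
    (hsim : ∀ a x y, ‖φ a x - φ a y‖ = r a * ‖x - y‖) (hX : IsCompact X)
    (hπ : ∀ (σ : ℕ → A) (n : ℕ), π σ ∈ iterMap φ (fun i : Fin n => σ i) '' X) :
    Measurable π := by
  obtain ⟨a₁, ha₁⟩ := Finite.exists_max r
  set f : ℕ → (ℕ → A) → EuclideanSpace ℝ (Fin d) :=
    fun n σ => π (fun i => if i < n then σ i else a₁) with hf
  refine measurable_of_tendsto_metrizable (f := f) (fun n => ?_) ?_
  · have hres : Measurable (fun (σ : ℕ → A) (i : Fin n) => σ i) := by fun_prop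
    have hfac : f n = (fun w : Fin n → A => π (fun i => if h : i < n then w ⟨i, h⟩ else a₁)) ∘
        (fun (σ : ℕ → A) (i : Fin n) => σ i) := by
      funext σ
      simp only [hf, Function.comp_apply]
      congr 1
    rw [hfac]
    exact (measurable_of_countable _).comp hres
  · rw [tendsto_pi_nhds]
    intro σ
    rw [tendsto_iff_norm_sub_tendsto_zero]
    have hlim : Tendsto (fun n => r a₁ ^ n * Metric.diam X) atTop (nhds 0) := by
      simpa using (tendsto_pow_atTop_nhds_zero_of_lt_one (hr a₁).1.le (hr a₁).2).mul_const
        (Metric.diam X)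
    refine squeeze_zero (fun n => norm_nonneg _) (fun n => ?_) hlim
    refine (norm_coding_sub_le hsim hr hX hπ (n := n) fun i hi => if_pos hi).trans ?_
    refine mul_le_mul_of_nonneg_right ?_ Metric.diam_nonneg
    calc _ ≤ ∏ _i ∈ Finset.range n, r a₁ :=
          Finset.prod_le_prod (fun i _ => (hr _).1.le) fun i _ => ha₁ _
      _ = _ := by simp

/-- If the shifts of `σ` by `l` and `n` agree along `k` letters, then `σ` agrees with the eventually
periodic sequence of its prefix of length `n` along `n + k` letters. -/
lemma evp_eq_of_repeat {σ : ℕ → A} {l n k : ℕ} (h : l < n)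
    (hrep : ∀ i < k, σ (l + i) = σ (n + i)) :
    ∀ i < n + k, σ i = evp (fun j : Fin n => σ j) l h i := by
  have hmod : ∀ i, l ≤ i → evp (fun j : Fin n => σ j) l h i = σ (l + (i - l) % (n - l)) := by
    intro i hi
    simp [evp, not_lt.2 hi]
  intro i
  induction i using Nat.strong_induction_on with
  | _ i ih =>
    intro hi
    rcases lt_or_ge i l with hil | hil
    · simp [evp, hil]
    rcases lt_or_ge i n with hin | hin
    · rw [hmod i hil, Nat.mod_eq_of_lt (by omega), show l + (i - l) = i by omega]
    · have h1 := ih (l + (i - n)) (by omega) (by omega)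
      have h2 := hrep (i - n) (by omega)
      rw [show n + (i - n) = i by omega] at h2
      rw [← h2, h1, hmod _ (by omega), hmod _ hil, Nat.mod_eq_sub_mod (a := i - l) (by omega),
        show l + (i - n) - l = i - l - (n - l) by omega]

lemma norm_coding_sub_evp_lt (hsim : ∀ a x y, ‖φ a x - φ a y‖ = r a * ‖x - y‖)
    (hr : ∀ a, r a ∈ Set.Ioo (0 : ℝ) 1) (hX : IsCompact X) (hdiam : 0 < Metric.diam X)
    (hπ : ∀ (σ : ℕ → A) (n : ℕ), π σ ∈ iterMap φ (fun i : Fin n => σ i) '' X)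
    {ρ : ℝ} {N l n : ℕ} (h : l < n) {σ : ℕ → A} (hσ : σ ∈ repeatEvent r ρ N l n) :
    ‖π σ - π (evp (fun j : Fin n => σ j) l h)‖ <
      Metric.diam (iterMap φ (fun j : Fin n => σ j) '' X) * ρ := by
  rw [repeatEvent_comm] at hσ
  obtain ⟨k, -, hk, hrep⟩ := hσ
  refine (norm_coding_sub_le hsim hr hX hπ
    (evp_eq_of_repeat h fun i hi => (hrep i hi).symm)).trans_lt ?_
  rw [diam_iterMap_image hr hsim hX, Fin.prod_univ_eq_prod_range (fun i => r (σ i)) n,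
    Finset.prod_range_add, mul_assoc, mul_assoc, mul_comm (Metric.diam X)]
  have hpos : 0 < ∏ i ∈ Finset.range n, r (σ i) := Finset.prod_pos fun i _ => (hr _).1
  exact mul_lt_mul_of_pos_left (mul_lt_mul_of_pos_right hk hdiam) hpos

end Coding

/-- Theorem 1.1(2) of the paper: under the entropy condition
`h_p < −2·log Σ_a p_a²` (with `p_a = r_a^{dim_S Φ}`), for non-increasing `g` with
`Σ_n Σ_{a∈A^n} n·(diam(X_a)·g(n))^{dim_S Φ} = ∞`, letting `Ψ(a) = diam(X_a)·g(|a|)`,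
the self-similar measure `μ = π_*𝔪` gives `μ(W_Φ(Ψ)) = 1`. -/
theorem statement1 {d : ℕ} {A : Type*} [Fintype A] [MeasurableSpace A]
    [MeasurableSingletonClass A]
    (hA : 2 ≤ Fintype.card A)
    (φ : A → EuclideanSpace ℝ (Fin d) → EuclideanSpace ℝ (Fin d))
    (r : A → ℝ) (hr : ∀ a, r a ∈ Set.Ioo (0 : ℝ) 1)
    (hsim : ∀ a x y, ‖φ a x - φ a y‖ = r a * ‖x - y‖)
    (X : Set (EuclideanSpace ℝ (Fin d)))
    (hXne : X.Nonempty) (hXcomp : IsCompact X)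
    (hXinv : X = ⋃ a, φ a '' X)
    (π : (ℕ → A) → EuclideanSpace ℝ (Fin d))
    (hπ : ∀ (σ : ℕ → A) (n : ℕ), π σ ∈ iterMap φ (fun i : Fin n => σ i) '' X)
    -- the similarity dimension
    (sdim : ℝ) (hsdim : 0 < sdim) (hsum1 : ∑ a : A, r a ^ sdim = 1)
    -- the entropy condition `h_p < −2 log Σ p_a²` for `p_a = r_a ^ sdim`
    (hent : (-∑ a : A, r a ^ sdim * Real.log (r a ^ sdim)) <
      -2 * Real.log (∑ a : A, (r a ^ sdim) ^ 2))
    -- the Bernoulli measure `𝔪` with marginal `p`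
    (𝔪 : Measure (ℕ → A)) [IsProbabilityMeasure 𝔪]
    (h𝔪 : ∀ (n : ℕ) (a : Fin n → A), 𝔪 (cyl a) = ENNReal.ofReal (∏ i, r (a i) ^ sdim))
    (g : ℕ → ℝ) (hg0 : ∀ n, 0 ≤ g n) (hganti : ∀ n, 1 ≤ n → g (n + 1) ≤ g n)
    (hdiv : ¬ Summable fun n : ℕ =>
      ∑ a : Fin n → A, (n : ℝ) * (Metric.diam (iterMap φ a '' X) * g n) ^ sdim) :
    Measure.map π 𝔪 (limsupW π (fun n a => Metric.diam (iterMap φ a '' X) * g n)) = 1 := by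
  classical
  have hne : Nonempty A := Fintype.card_pos_iff.1 (by omega)
  have hπm : Measurable π := measurable_coding hr hsim hXcomp hπ
  have hp0 : ∀ a, 0 ≤ r a ^ sdim := fun a => Real.rpow_nonneg (hr a).1.le sdim
  have hterm : ∀ n : ℕ,
      ∑ a : Fin n → A, (n : ℝ) * (Metric.diam (iterMap φ a '' X) * g n) ^ sdim =
        Metric.diam X ^ sdim * ((n : ℝ) * g n ^ sdim) := by
    intro n
    have hw : ∀ a : Fin n → A, (n : ℝ) * (Metric.diam (iterMap φ a '' X) * g n) ^ sdim =
        (Metric.diam X ^ sdim * ((n : ℝ) * g n ^ sdim)) * ∏ i, r (a i) ^ sdim := by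
      intro a
      have hR : 0 ≤ ∏ i, r (a i) := Finset.prod_nonneg fun i _ => (hr _).1.le
      rw [diam_iterMap_image hr hsim hXcomp,
        Real.mul_rpow (mul_nonneg hR Metric.diam_nonneg) (hg0 n),
        Real.mul_rpow hR Metric.diam_nonneg, Real.finsetProd_rpow _ _ fun i _ => (hr _).1.le]
      ring
    have hsum : ∑ a : Fin n → A, ∏ i, r (a i) ^ sdim = 1 := by
      rw [← Fintype.piFinset_univ,
        ← Finset.sum_pow' (Finset.univ : Finset A) (fun a => r a ^ sdim) n, hsum1, one_pow]
    simp_rw [hw]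
    rw [← Finset.mul_sum, hsum, mul_one]
  simp_rw [hterm] at hdiv
  have hdiam : 0 < Metric.diam X := by
    refine lt_of_le_of_ne Metric.diam_nonneg fun h => hdiv ?_
    rw [← h, Real.zero_rpow hsdim.ne']
    simp
  have hdiv' := not_summable_condensed_min hg0 hganti hsdim fun h => hdiv (h.mul_left _)
  have hae := ae_frequently_mem_blockEvent hr hsdim 𝔪 h𝔪 (fun i => min (g (2 ^ (i + 3))) 1)
    (fun i => le_min (hg0 _) zero_le_one) (fun i => min_le_right _ _) hdiv'
  have hanti : ∀ m n, 1 ≤ m → m ≤ n → g n ≤ g m := by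
    intro m n hm hmn
    induction n, hmn using Nat.le_induction with
    | base => exact le_rfl
    | succ k hk ih => exact (hganti k (hm.trans hk)).trans ih
  have hmem : ∀ᵐ σ ∂𝔪, σ ∈ π ⁻¹'
      limsupW π (fun n a => Metric.diam (iterMap φ a '' X) * g n) := by
    filter_upwards [hae] with σ hσ
    refine Filter.frequently_atTop.2 fun b => ?_
    obtain ⟨i, hi, hσi⟩ := Filter.frequently_atTop.1 hσ b
    simp only [blockEvent, Set.mem_iUnion, exists_prop, Finset.mem_product,
      Finset.mem_range] at hσi
    obtain ⟨⟨u, v⟩, ⟨hu, hv⟩, hrep⟩ := hσi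
    simp only at hu hv hrep
    have hib : i < 2 ^ i := Nat.lt_two_pow_self
    have hln : 4 * 2 ^ i + u < 6 * 2 ^ i + v := by omega
    refine ⟨6 * 2 ^ i + v, by omega, fun j => σ j, 4 * 2 ^ i + u, hln, ?_⟩
    refine (norm_coding_sub_evp_lt hsim hr hXcomp hdiam hπ hln hrep).trans_le ?_
    refine mul_le_mul_of_nonneg_left ((min_le_left _ _).trans (hanti _ _ (by omega) ?_))
      Metric.diam_nonneg
    rw [pow_add]
    omega
  have hprob : IsProbabilityMeasure (Measure.map π 𝔪) :=
    Measure.isProbabilityMeasure_map hπm.aemeasurable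
  refine le_antisymm prob_le_one ?_
  refine le_trans (le_of_eq ?_) (Measure.le_map_apply hπm.aemeasurable _)
  exact ((measure_congr (ae_eq_univ.2 (mem_ae_iff.1 hmem))).trans measure_univ).symm
end
end
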